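/- Let u_k : ℝ × ℝ × ℝ × ℝ → ℝ be defined by u₀(x,y,z,t) = t·(x² + y² - z²) + (t²/2)·(x² + y² + z²) and, for k ≥ 1, u_k(x,y,z,t) = u₀(x,y,z,t) + (1/2)·∫₀ᵗ (t - ξ)·( x²·∂²u_{k-1}/∂x²(x,y,z,ξ) + y²·∂²u_{k-1}/∂y²(x,y,z,ξ) + z²·∂²u_{k-1}/∂z²(x,y,z,ξ) ) dξ. Then for every fixed (x, y, z, t) ∈ ℝ⁴, the sequence (u_k(x,y,z,t))_{k=0}^∞ converges to (x² + y²)·e^t + z²·e^{-t} - (x² + y² + z²) as k → ∞. -/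

import Mathlib

/-- The partial sum `∑ t ^ (j + 1) / (j + 1)!`, `j < n`, of the series of `exp t - 1`. -/
noncomputable def expSubOnePartialSum (n : ℕ) (t : ℝ) : ℝ :=
  ∑ j ∈ Finset.range n, t ^ (j + 1) / (j + 1).factorial

theorem continuous_expSubOnePartialSum (n : ℕ) : Continuous (expSubOnePartialSum n) := by
  unfold expSubOnePartialSum
  fun_prop

theorem expSubOnePartialSum_two (t : ℝ) : expSubOnePartialSum 2 t = t + t ^ 2 / 2 := by
  simp [expSubOnePartialSum, Finset.sum_range_succ]

theorem tendsto_expSubOnePartialSum (t : ℝ) :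
    Filter.Tendsto (fun n => expSubOnePartialSum n t) Filter.atTop (nhds (Real.exp t - 1)) := by
  have h : HasSum (fun n : ℕ => t ^ n / n.factorial) (Real.exp t) := by
    rw [Real.exp_eq_exp_ℝ]
    exact NormedSpace.expSeries_div_hasSum_exp t
  simpa [expSubOnePartialSum] using ((hasSum_nat_add_iff' 1).2 h).tendsto_sum_nat

theorem integral_sub_mul_pow (m : ℕ) (t : ℝ) :
    ∫ ξ in (0 : ℝ)..t, (t - ξ) * ξ ^ m = t ^ (m + 2) / ((m + 1) * (m + 2)) := by
  have h : ∀ ξ : ℝ, (t - ξ) * ξ ^ m = t * ξ ^ m - ξ ^ (m + 1) := fun ξ => by ring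
  simp only [h]
  rw [intervalIntegral.integral_sub
    ((by fun_prop : Continuous fun ξ : ℝ => t * ξ ^ m).intervalIntegrable _ _)
    ((by fun_prop : Continuous fun ξ : ℝ => ξ ^ (m + 1)).intervalIntegrable _ _),
    intervalIntegral.integral_const_mul, integral_pow, integral_pow]
  have h₁ : (m : ℝ) + 1 ≠ 0 := by positivity
  have h₂ : (m : ℝ) + 2 ≠ 0 := by positivity
  have h₃ : (m : ℝ) + 1 + 1 ≠ 0 := by positivity
  push_cast
  rw [zero_pow (by omega), zero_pow (by omega)]
  field_simp
  ring

theorem integral_sub_mul_expSubOnePartialSum (n : ℕ) {s : ℝ} (hs : s ^ 2 = 1) (t : ℝ) :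
    ∫ ξ in (0 : ℝ)..t, (t - ξ) * expSubOnePartialSum n (s * ξ) =
      expSubOnePartialSum (n + 2) (s * t) - expSubOnePartialSum 2 (s * t) := by
  have hterm : ∀ (j : ℕ) (ξ : ℝ), (t - ξ) * ((s * ξ) ^ (j + 1) / (j + 1).factorial) =
      s ^ (j + 1) / (j + 1).factorial * ((t - ξ) * ξ ^ (j + 1)) := fun j ξ => by
    rw [mul_pow]; ring
  simp only [expSubOnePartialSum, Finset.mul_sum]
  rw [intervalIntegral.integral_finsetSum fun j _ =>
    (by fun_prop : Continuous fun ξ : ℝ =>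
      (t - ξ) * ((s * ξ) ^ (j + 1) / (j + 1).factorial)).intervalIntegrable _ _,
    add_comm n 2, Finset.sum_range_add, add_sub_cancel_left]
  refine Finset.sum_congr rfl fun j _ => ?_
  simp only [hterm]
  rw [intervalIntegral.integral_const_mul, integral_sub_mul_pow,
    show 2 + j + 1 = j + 1 + 1 + 1 by ring, Nat.factorial_succ (j + 1 + 1),
    Nat.factorial_succ (j + 1), mul_pow, show s ^ (j + 1 + 1 + 1) = s ^ (j + 1) * s ^ 2 by ring, hs]
  have hf : ((j + 1).factorial : ℝ) ≠ 0 := by positivity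
  push_cast
  field_simp
  ring

theorem iteratedDeriv_two_sq_mul_add (a b x : ℝ) :
    iteratedDeriv 2 (fun v : ℝ => v ^ 2 * a + b) x = 2 * a := by
  have h : deriv (fun v : ℝ => v ^ 2 * a + b) = fun v => v * (2 * a) := by
    funext v
    simp [mul_comm, mul_left_comm]
  rw [iteratedDeriv_succ, iteratedDeriv_one, h]
  simp


/-- Example 4, convergence: the iterates `u₀ = t(x²+y²-z²) + (t²/2)(x²+y²+z²)`,
`u_{k+1} = u₀ + (1/2)∫₀ᵗ (t-ξ)(x²∂²u_k/∂x² + y²∂²u_k/∂y² + z²∂²u_k/∂z²) dξ`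
converge pointwise to the exact solution `(x²+y²)e^t + z²e^{-t} - (x²+y²+z²)`. -/
theorem stmt_14 (u : ℕ → ℝ → ℝ → ℝ → ℝ → ℝ)
    (hu0 : ∀ x y z t : ℝ, u 0 x y z t =
      t * (x ^ 2 + y ^ 2 - z ^ 2) + t ^ 2 / 2 * (x ^ 2 + y ^ 2 + z ^ 2))
    (huk : ∀ k : ℕ, ∀ x y z t : ℝ, u (k + 1) x y z t = u 0 x y z t +
      1 / 2 * ∫ ξ in (0 : ℝ)..t, (t - ξ) *
        (x ^ 2 * iteratedDeriv 2 (fun x' => u k x' y z ξ) x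
          + y ^ 2 * iteratedDeriv 2 (fun y' => u k x y' z ξ) y
          + z ^ 2 * iteratedDeriv 2 (fun z' => u k x y z' ξ) z)) :
    ∀ x y z t : ℝ,
      Filter.Tendsto (fun k => u k x y z t) Filter.atTop
        (nhds ((x ^ 2 + y ^ 2) * Real.exp t + z ^ 2 * Real.exp (-t)
          - (x ^ 2 + y ^ 2 + z ^ 2))) := by
  have key : ∀ k x y z t, u k x y z t =
      (x ^ 2 + y ^ 2) * expSubOnePartialSum (2 * k + 2) t +
        z ^ 2 * expSubOnePartialSum (2 * k + 2) (-t) := by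
    intro k
    induction k with
    | zero =>
      intro x y z t
      rw [hu0, mul_zero, zero_add, expSubOnePartialSum_two, expSubOnePartialSum_two]
      ring
    | succ k ih =>
      intro x y z t
      set E := expSubOnePartialSum (2 * k + 2) with hE
      have hEc : Continuous E := continuous_expSubOnePartialSum _
      have hint : ∀ ξ : ℝ, (t - ξ) *
          (x ^ 2 * iteratedDeriv 2 (fun x' => u k x' y z ξ) x
            + y ^ 2 * iteratedDeriv 2 (fun y' => u k x y' z ξ) y
            + z ^ 2 * iteratedDeriv 2 (fun z' => u k x y z' ξ) z) =
          2 * (x ^ 2 + y ^ 2) * ((t - ξ) * E (1 * ξ)) +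
            2 * z ^ 2 * ((t - ξ) * E (-1 * ξ)) := by
        intro ξ
        have hx : (fun x' => u k x' y z ξ) =
            fun v => v ^ 2 * E ξ + (y ^ 2 * E ξ + z ^ 2 * E (-ξ)) := by
          funext v; rw [ih]; ring
        have hy : (fun y' => u k x y' z ξ) =
            fun v => v ^ 2 * E ξ + (x ^ 2 * E ξ + z ^ 2 * E (-ξ)) := by
          funext v; rw [ih]; ring
        have hz : (fun z' => u k x y z' ξ) =
            fun v => v ^ 2 * E (-ξ) + (x ^ 2 + y ^ 2) * E ξ := by
          funext v; rw [ih]; ring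
        rw [hx, hy, hz, iteratedDeriv_two_sq_mul_add, iteratedDeriv_two_sq_mul_add,
          iteratedDeriv_two_sq_mul_add, one_mul, neg_one_mul]
        ring
      rw [huk, hu0]
      simp only [hint]
      rw [intervalIntegral.integral_add
        ((by fun_prop : Continuous fun ξ : ℝ =>
          2 * (x ^ 2 + y ^ 2) * ((t - ξ) * E (1 * ξ))).intervalIntegrable _ _)
        ((by fun_prop : Continuous fun ξ : ℝ =>
          2 * z ^ 2 * ((t - ξ) * E (-1 * ξ))).intervalIntegrable _ _),
        intervalIntegral.integral_const_mul, intervalIntegral.integral_const_mul, hE,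
        integral_sub_mul_expSubOnePartialSum _ (by norm_num),
        integral_sub_mul_expSubOnePartialSum _ (by norm_num),
        expSubOnePartialSum_two, expSubOnePartialSum_two, one_mul, neg_one_mul,
        show 2 * (k + 1) + 2 = 2 * k + 2 + 2 by ring]
      ring
  intro x y z t
  simp only [key]
  have hk : Filter.Tendsto (fun k : ℕ => 2 * k + 2) Filter.atTop Filter.atTop :=
    Filter.tendsto_atTop_mono (fun k => show k ≤ 2 * k + 2 by omega) Filter.tendsto_id
  convert (((tendsto_expSubOnePartialSum t).comp hk).const_mul (x ^ 2 + y ^ 2)).add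
    (((tendsto_expSubOnePartialSum (-t)).comp hk).const_mul (z ^ 2)) using 2
  · rfl
  · ring
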